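/- arXiv:2406.16785 — 7 statements merged into one kernel-verified Lean document; each statement's English description precedes it below -/
import Mathlib

section
/- Criterion of modal equivalence (Lemma 3.2): Let L be either L⁻ or L⁺. If pointed simplicial models (𝒞,Y) and (𝒞',Y') satisfy, for every formula φ ∈ L, that 𝒞,Y ⊨ φ if and only if 𝒞',Y' ⊨ φ, then (𝒞,Y) ≡_L (𝒞',Y'). -/
namespace ISC

/-- Epistemic language `L⁺`: global atoms, local atoms, negation, conjunction,
and the possibility modality `K̂ₐ`. Local atoms are elements of `P`, with
`π : P → A` assigning to each local atom its owner agent. -/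
inductive Form (A P : Type) : Type where
  | glob : A → Form A P
  | atom : P → Form A P
  | neg  : Form A P → Form A P
  | conj : Form A P → Form A P → Form A P
  | know : A → Form A P → Form A P

/-- Formulas of the language `L⁻`, i.e., without global atoms. -/
def Form.NoGlobal {A P : Type} : Form A P → Prop
  | .glob _ => False
  | .atom _ => True
  | .neg φ => φ.NoGlobal
  | .conj φ ψ => φ.NoGlobal ∧ ψ.NoGlobal
  | .know _ φ => φ.NoGlobal

/-- Subformula relation. -/
inductive Form.Subformula {A P : Type} : Form A P → Form A P → Prop where
  | refl (φ : Form A P) : Form.Subformula φ φ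
  | neg {ψ φ : Form A P} : Form.Subformula ψ φ → Form.Subformula ψ (.neg φ)
  | conj_left {ψ φ χ : Form A P} : Form.Subformula ψ φ → Form.Subformula ψ (.conj φ χ)
  | conj_right {ψ φ χ : Form A P} : Form.Subformula ψ χ → Form.Subformula ψ (.conj φ χ)
  | know {ψ φ : Form A P} {a : A} : Form.Subformula ψ φ → Form.Subformula ψ (.know a φ)

/-- A (data of a) simplicial model: a collection of simplexes (sets of vertices),
a chromatic map and a valuation. -/
structure SimpModel (A P : Type) (π : P → A) (V : Type) : Type where
  C : Set (Set V)
  χ : V → A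
  ℓ : V → Set P

namespace SimpModel

variable {A P : Type} {π : P → A} {V V' : Type}

/-- The axioms of a simplicial model. -/
def IsWellFormed (M : SimpModel A P π V) : Prop :=
  M.C.Nonempty ∧
  (∀ X ∈ M.C, X.Finite ∧ X.Nonempty) ∧
  (∀ X ∈ M.C, ∀ Y : Set V, Y.Nonempty → Y ⊆ X → Y ∈ M.C) ∧
  (∀ v : V, {v} ∈ M.C) ∧
  (∀ X ∈ M.C, ∀ u ∈ X, ∀ w ∈ X, M.χ u = M.χ w → u = w) ∧
  (∀ v : V, ∀ p ∈ M.ℓ v, π p = M.χ v)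

/-- A facet: a ⊆-maximal simplex. -/
def isFacet (M : SimpModel A P π V) (X : Set V) : Prop :=
  X ∈ M.C ∧ ∀ Y ∈ M.C, X ⊆ Y → X = Y

/-- `ℓ(X)`, the local atoms of a simplex. -/
def lab (M : SimpModel A P π V) (X : Set V) : Set P := ⋃ v ∈ X, M.ℓ v

/-- Definability `𝒞,X ⋈ φ`. -/
def defined (M : SimpModel A P π V) : Set V → Form A P → Prop
  | _, .glob _ => True
  | X, .atom p => π p ∈ M.χ '' X
  | X, .neg φ => M.defined X φ
  | X, .conj φ ψ => M.defined X φ ∧ M.defined X ψ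
  | X, .know a φ => ∃ Y : Set V, M.isFacet Y ∧ a ∈ M.χ '' (X ∩ Y) ∧ M.defined Y φ

/-- Satisfaction `𝒞,X ⊨ φ`. -/
def sat (M : SimpModel A P π V) : Set V → Form A P → Prop
  | X, .glob a => a ∈ M.χ '' X
  | X, .atom p => p ∈ M.lab X
  | X, .neg φ => M.defined X φ ∧ ¬ M.sat X φ
  | X, .conj φ ψ => M.sat X φ ∧ M.sat X ψ
  | X, .know a φ => ∃ Y : Set V, M.isFacet Y ∧ a ∈ M.χ '' (X ∩ Y) ∧ M.sat Y φ

/-- Star-finiteness: each facet has only finitely many `a`-adjacent facets. -/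
def StarFinite (M : SimpModel A P π V) : Prop :=
  ∀ (a : A) (X : Set V), M.isFacet X →
    {Y : Set V | M.isFacet Y ∧ a ∈ M.χ '' (X ∩ Y)}.Finite

end SimpModel

/-- Modal equivalence of pointed simplicial models in a language `L`. -/
def ModEquiv {A P : Type} {π : P → A} {V V' : Type} (L : Set (Form A P))
    (M : SimpModel A P π V) (X : Set V)
    (M' : SimpModel A P π V') (X' : Set V') : Prop :=
  ∀ φ ∈ L,
    (M.defined X φ ↔ M'.defined X' φ) ∧
    (M.sat X φ ↔ M'.sat X' φ) ∧
    (M.sat X (.neg φ) ↔ M'.sat X' (.neg φ))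

/-- `B` is a bisimulation between the simplicial models `M` and `M'`. -/
def IsBisim {A P : Type} {π : P → A} {V V' : Type}
    (M : SimpModel A P π V) (M' : SimpModel A P π V')
    (B : Set V → Set V' → Prop) : Prop :=
  (∃ X X', B X X') ∧
  (∀ X X', B X X' → M.isFacet X ∧ M'.isFacet X') ∧
  (∀ X X', B X X' →
    (M.χ '' X = M'.χ '' X' ∧ M.lab X = M'.lab X') ∧
    (∀ (a : A) (Y : Set V), M.isFacet Y → a ∈ M.χ '' (X ∩ Y) →
      ∃ Y' : Set V', M'.isFacet Y' ∧ a ∈ M'.χ '' (X' ∩ Y') ∧ B Y Y') ∧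
    (∀ (a : A) (Y' : Set V'), M'.isFacet Y' → a ∈ M'.χ '' (X' ∩ Y') →
      ∃ Y : Set V, M.isFacet Y ∧ a ∈ M.χ '' (X ∩ Y) ∧ B Y Y'))

/-- Bisimilarity of pointed simplicial models. -/
def Bisimilar {A P : Type} {π : P → A} {V V' : Type}
    (M : SimpModel A P π V) (X : Set V)
    (M' : SimpModel A P π V') (X' : Set V') : Prop :=
  ∃ B, IsBisim M M' B ∧ B X X'

/-- Labeled rooted trees: a node carries a set of agents, each edge to a child
carries an agent. -/
inductive LTree (A : Type) : Type where
  | node : Set A → List (A × LTree A) → LTree A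

namespace LTree

/-- The label of the root. -/
def label {A : Type} : LTree A → Set A
  | .node s _ => s

/-- The list of children of the root, paired with their edge labels. -/
def children {A : Type} : LTree A → List (A × LTree A)
  | .node _ cs => cs

/-- The `a`-grafting: add `a` to the root label. -/
def graft {A : Type} (a : A) : LTree A → LTree A
  | .node s cs => .node (insert a s) cs

/-- The life-tree condition: every `a`-edge satisfies `a ∈ L(σ) ∩ L(τ)`. -/
def IsLife {A : Type} : LTree A → Prop
  | .node s cs => ∀ p ∈ cs, p.1 ∈ s ∧ p.1 ∈ p.2.label ∧ p.2.IsLife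
  decreasing_by
    rename_i h
    have h2 := List.sizeOf_lt_of_mem h
    obtain ⟨x, y⟩ := p
    simp at h2 ⊢
    omega

end LTree

/-- The life tree `ℒ⟨φ⟩` of a formula. -/
def Form.lifeTree {A P : Type} (π : P → A) : Form A P → LTree A
  | .glob _ => .node ∅ []
  | .atom p => .node {π p} []
  | .neg φ => φ.lifeTree π
  | .conj φ ψ =>
      .node ((φ.lifeTree π).label ∪ (ψ.lifeTree π).label)
            ((φ.lifeTree π).children ++ (ψ.lifeTree π).children)
  | .know a φ => .node {a} [(a, LTree.graft a (φ.lifeTree π))]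

/-- `𝒞,X ⋈ 𝔗`: there is an embedding of the tree `𝔗` into `(𝒞,X)`, i.e., a map
from tree nodes to facets sending the root to `X`, node labels into the colors
of the corresponding facets, and every `a`-edge to a pair of `a`-adjacent facets. -/
def SimpModel.Embeds {A P : Type} {π : P → A} {V : Type}
    (M : SimpModel A P π V) : Set V → LTree A → Prop
  | X, .node s cs =>
      s ⊆ M.χ '' X ∧
      ∀ p ∈ cs, ∃ Y : Set V, M.isFacet Y ∧ p.1 ∈ M.χ '' (X ∩ Y) ∧ M.Embeds Y p.2
  decreasing_by
    rename_i h
    have h2 := List.sizeOf_lt_of_mem h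
    obtain ⟨x, y⟩ := p
    simp at h2 ⊢
    omega

/-- A (data of a) partial epistemic model: a relation for every agent and a
valuation assigning to states sets of global (`Sum.inl`) and local (`Sum.inr`) atoms. -/
structure PEModel (A P : Type) (π : P → A) (S : Type) : Type where
  rel : A → S → S → Prop
  L : S → Set (A ⊕ P)

namespace PEModel

variable {A P : Type} {π : P → A} {S S' : Type}

/-- The axioms of a partial epistemic model: each `∼ₐ` is a partial equivalence
relation (symmetric and transitive) and proper, local atoms of live agents are
constant on `∼ₐ`-classes, and the global atom `a` holds exactly where `a` is alive. -/
def IsWellFormed (M : PEModel A P π S) : Prop :=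
  (∀ (a : A) (s t : S), M.rel a s t → M.rel a t s) ∧
  (∀ (a : A) (s t u : S), M.rel a s t → M.rel a t u → M.rel a s u) ∧
  (∀ s t : S, s ≠ t → ∃ b : A, M.rel b s s ∧ ¬ M.rel b s t) ∧
  (∀ (a : A) (p : P), π p = a → ∀ s t : S, M.rel a s t →
      (Sum.inr p ∈ M.L s ↔ Sum.inr p ∈ M.L t)) ∧
  (∀ (a : A) (s : S), Sum.inl a ∈ M.L s ↔ M.rel a s s)

/-- Definability `M,s ⋈ φ` on partial epistemic models. -/
def defined (M : PEModel A P π S) : S → Form A P → Prop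
  | _, .glob _ => True
  | s, .atom p => M.rel (π p) s s
  | s, .neg φ => M.defined s φ
  | s, .conj φ ψ => M.defined s φ ∧ M.defined s ψ
  | s, .know a φ => ∃ t : S, M.rel a t s ∧ M.defined t φ

/-- Satisfaction `M,s ⊨ φ` on partial epistemic models. -/
def sat (M : PEModel A P π S) : S → Form A P → Prop
  | s, .glob a => M.rel a s s
  | s, .atom p => M.rel (π p) s s ∧ Sum.inr p ∈ M.L s
  | s, .neg φ => M.defined s φ ∧ ¬ M.sat s φ
  | s, .conj φ ψ => M.sat s φ ∧ M.sat s ψ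
  | s, .know a φ => ∃ t : S, M.rel a t s ∧ M.sat t φ

/-- Image-finiteness: every `∼ₐ`-equivalence class is finite. -/
def ImageFinite (M : PEModel A P π S) : Prop :=
  ∀ (a : A) (s : S), M.rel a s s → {t : S | M.rel a s t}.Finite

/-- The `∼ₐ`-class `[s]ₐ`. -/
def cls (M : PEModel A P π S) (a : A) (s : S) : Set S := {t | M.rel a s t}

/-- Vertices of `σ(M)`: pairs `([s]ₐ, a)` with `a` alive in `s`. -/
def SVtx (M : PEModel A P π S) : Type :=
  {va : Set S × A // ∃ s : S, M.rel va.2 s s ∧ va.1 = M.cls va.2 s}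

/-- The set of vertices `{([s]ₐ, a) | a ∈ B}`. -/
def sigmaSet (M : PEModel A P π S) (s : S) (B : Set A) : Set M.SVtx :=
  {v : M.SVtx | v.val.2 ∈ B ∧ v.val.1 = M.cls v.val.2 s}

/-- The simplicial model `σ(M)` associated with a partial epistemic model. -/
def sigma (M : PEModel A P π S) : SimpModel A P π M.SVtx where
  C := {X : Set M.SVtx |
    ∃ (s : S) (B : Set A), B.Nonempty ∧ (∀ a ∈ B, M.rel a s s) ∧ X = M.sigmaSet s B}
  χ := fun v => v.val.2
  ℓ := fun v => {p : P | π p = v.val.2 ∧ ∃ t ∈ v.val.1, Sum.inr p ∈ M.L t}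

/-- The facet `σ(s) = {([s]ₐ, a) | a ∈ Aₛ}`. -/
def sigmaF (M : PEModel A P π S) (s : S) : Set M.SVtx :=
  M.sigmaSet s {a : A | M.rel a s s}

end PEModel

/-- The partial epistemic model `κ(𝒞)` associated with a simplicial model:
states are the facets, `X ∼ₐ Y` iff `a ∈ χ(X ∩ Y)`, and `L(X) = ℓ(X) ∪ χ(X)`. -/
def SimpModel.kappa {A P : Type} {π : P → A} {V : Type} (M : SimpModel A P π V) :
    PEModel A P π {X : Set V // M.isFacet X} where
  rel := fun a X Y => a ∈ M.χ '' (X.val ∩ Y.val)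
  L := fun X => (Sum.inl '' (M.χ '' X.val)) ∪ (Sum.inr '' M.lab X.val)

/-- `Z` is a life bisimulation between partial epistemic models. -/
def IsLifeBisim {A P : Type} {π : P → A} {S S' : Type}
    (M : PEModel A P π S) (M' : PEModel A P π S') (Z : S → S' → Prop) : Prop :=
  (∃ s s', Z s s') ∧
  ∀ s s', Z s s' →
    ((∀ a : A, Sum.inl a ∈ M.L s ↔ Sum.inl a ∈ M'.L s') ∧
     (∀ a : A, M.rel a s s → ∀ p : P, π p = a →
        (Sum.inr p ∈ M.L s ↔ Sum.inr p ∈ M'.L s'))) ∧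
    (∀ a : A, M.rel a s s → ∀ t : S, M.rel a t s →
        ∃ t' : S', M'.rel a t' s' ∧ Z t t') ∧
    (∀ a : A, M'.rel a s' s' → ∀ t' : S', M'.rel a t' s' →
        ∃ t : S, M.rel a t s ∧ Z t t')

/-- `Z` is a standard bisimulation between partial epistemic models. -/
def IsStdBisim {A P : Type} {π : P → A} {S S' : Type}
    (M : PEModel A P π S) (M' : PEModel A P π S') (Z : S → S' → Prop) : Prop :=
  (∃ s s', Z s s') ∧
  ∀ s s', Z s s' →
    ((∀ a : A, Sum.inl a ∈ M.L s ↔ Sum.inl a ∈ M'.L s') ∧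
     (∀ p : P, Sum.inr p ∈ M.L s ↔ Sum.inr p ∈ M'.L s')) ∧
    (∀ (a : A) (t : S), M.rel a t s → ∃ t' : S', M'.rel a t' s' ∧ Z t t') ∧
    (∀ (a : A) (t' : S'), M'.rel a t' s' → ∃ t : S, M.rel a t s ∧ Z t t')

/-- Modal equivalence of pointed partial epistemic models (in `L⁺`). -/
def ModEquivPar {A P : Type} {π : P → A} {S S' : Type}
    (M : PEModel A P π S) (s : S) (M' : PEModel A P π S') (s' : S') : Prop :=
  ∀ φ : Form A P,
    (M.defined s φ ↔ M'.defined s' φ) ∧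
    (M.sat s φ ↔ M'.sat s' φ) ∧
    (M.sat s (.neg φ) ↔ M'.sat s' (.neg φ))


/-- A formula expressing definability of `φ`: it holds exactly where `φ` is defined. -/
def Form.definability {A P : Type} : Form A P → Form A P
  | .glob a => .neg (.conj (.glob a) (.neg (.glob a)))
  | .atom p => .neg (.conj (.atom p) (.neg (.atom p)))
  | .neg φ => φ.definability
  | .conj φ ψ => .conj φ.definability ψ.definability
  | .know a φ => .know a φ.definability

theorem Form.NoGlobal.definability {A P : Type} {φ : Form A P} (hφ : φ.NoGlobal) :
    φ.definability.NoGlobal := by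
  induction φ with
  | glob a => exact hφ.elim
  | atom p => exact ⟨trivial, trivial⟩
  | neg φ ih => exact ih hφ
  | conj φ ψ ih₁ ih₂ => exact ⟨ih₁ hφ.1, ih₂ hφ.2⟩
  | know a φ ih => exact ih hφ

theorem SimpModel.sat_definability {A P V : Type} {π : P → A} (M : SimpModel A P π V)
    (X : Set V) (φ : Form A P) : M.sat X φ.definability ↔ M.defined X φ := by
  induction φ generalizing X with
  | glob a => simp [Form.definability, SimpModel.sat, SimpModel.defined]
  | atom p =>
    simp only [Form.definability, SimpModel.sat, SimpModel.defined]
    tauto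
  | neg φ ih => exact ih X
  | conj φ ψ ih₁ ih₂ => exact and_congr (ih₁ X) (ih₂ X)
  | know a φ ih => simp only [Form.definability, SimpModel.sat, SimpModel.defined, ih]

/-- **Lemma 3.2 (Criterion of modal equivalence).** Let `L` be either `L⁻` or `L⁺`.
If pointed simplicial models `(𝒞,Y)` and `(𝒞',Y')` satisfy, for every `φ ∈ L`,
`𝒞,Y ⊨ φ ↔ 𝒞',Y' ⊨ φ`, then `(𝒞,Y) ≡_L (𝒞',Y')`. -/
theorem criterion_of_modal_equivalence
    {A P V V' : Type} [Fintype A] [Countable P] {π : P → A}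
    (M : SimpModel A P π V) (M' : SimpModel A P π V')
    (hM : M.IsWellFormed) (hM' : M'.IsWellFormed)
    (Y : Set V) (Y' : Set V') (hY : M.isFacet Y) (hY' : M'.isFacet Y')
    (L : Set (Form A P))
    (hL : L = {φ : Form A P | φ.NoGlobal} ∨ L = Set.univ)
    (h : ∀ φ ∈ L, M.sat Y φ ↔ M'.sat Y' φ) :
    ModEquiv L M Y M' Y' := by
  intro φ hφ
  have hneg : Form.neg φ ∈ L := by
    rcases hL with rfl | rfl
    exacts [hφ, Set.mem_univ _]
  have hdef : φ.definability ∈ L := by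
    rcases hL with rfl | rfl
    exacts [Form.NoGlobal.definability hφ, Set.mem_univ _]
  refine ⟨?_, h φ hφ, h _ hneg⟩
  rw [← M.sat_definability, ← M'.sat_definability]
  exact h _ hdef

end ISC
end

section
/- Proposition 3.3: For the pointed simplicial models (𝒞,Y) and (𝒞',Y') described in the context (the models of Fig. 1), (𝒞,Y) ≡_{L⁻} (𝒞',Y'), i.e., they are modally equivalent in the language L⁻ without global atoms. -/
namespace ISC

/-- The simplicial model `𝒞` of Fig. 1: vertices `0 = w₁` (colored `b`),
`1 = v` (colored `a`), `2 = w₂` (colored `b`), `3 = u` (colored `c`);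
simplexes are the nonempty subsets of `X = {0,1}` and of `Y = {1,2,3}`. -/
def figC {A P : Type} (π : P → A) (a b c : A) (La Lb Lc : Set P) :
    SimpModel A P π (Fin 4) where
  C := {Z : Set (Fin 4) | Z.Nonempty ∧ (Z ⊆ {0, 1} ∨ Z ⊆ {1, 2, 3})}
  χ := fun v => if v = 1 then a else if v = 3 then c else b
  ℓ := fun v => if v = 1 then La else if v = 3 then Lc else Lb

/-- The simplicial model `𝒞'` of Fig. 1: vertices `0 = v'` (colored `a`),
`1 = w'` (colored `b`), `2 = u'` (colored `c`); simplexes are the nonempty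
subsets of `Y' = {0,1,2}`. -/
def figC' {A P : Type} (π : P → A) (a b c : A) (La Lb Lc : Set P) :
    SimpModel A P π (Fin 3) where
  C := {Z : Set (Fin 3) | Z.Nonempty}
  χ := fun v => if v = 0 then a else if v = 1 then b else c
  ℓ := fun v => if v = 0 then La else if v = 1 then Lb else Lc

/-- A satisfied formula is defined, provided local atoms only decorate vertices of their owner. -/
theorem SimpModel.defined_of_sat {A P : Type} {π : P → A} {V : Type} (M : SimpModel A P π V)
    (hM : ∀ v, ∀ p ∈ M.ℓ v, π p = M.χ v) (φ : Form A P) (X : Set V) (h : M.sat X φ) :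
    M.defined X φ := by
  induction φ generalizing X with
  | glob a => trivial
  | atom p =>
    simp only [SimpModel.sat, SimpModel.lab, Set.mem_iUnion] at h
    obtain ⟨v, hv, hp⟩ := h
    exact ⟨v, hv, (hM v p hp).symm⟩
  | neg φ => exact h.1
  | conj φ ψ ihφ ihψ => exact ⟨ihφ X h.1, ihψ X h.2⟩
  | know a φ ih =>
    obtain ⟨Y, hY, ha, hs⟩ := h
    exact ⟨Y, hY, ha, ih Y hs⟩

section Fig

variable {A P : Type} {π : P → A} {a b c : A} {La Lb Lc : Set P}

theorem figC_isFacet_iff (Z : Set (Fin 4)) :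
    (figC π a b c La Lb Lc).isFacet Z ↔ Z = {0, 1} ∨ Z = {1, 2, 3} := by
  constructor
  · rintro ⟨⟨-, hZ | hZ⟩, hmax⟩
    · exact .inl (hmax _ ⟨⟨0, by simp⟩, .inl subset_rfl⟩ hZ)
    · exact .inr (hmax _ ⟨⟨1, by simp⟩, .inr subset_rfl⟩ hZ)
  · rintro (rfl | rfl)
    · refine ⟨⟨⟨0, by simp⟩, .inl subset_rfl⟩, fun Y hY hsub => ?_⟩
      rcases hY.2 with h | h
      · exact hsub.antisymm h
      · have := h (hsub (show (0 : Fin 4) ∈ _ by simp))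
        simp at this
    · refine ⟨⟨⟨1, by simp⟩, .inr subset_rfl⟩, fun Y hY hsub => ?_⟩
      rcases hY.2 with h | h
      · have := h (hsub (show (2 : Fin 4) ∈ _ by simp))
        simp at this
      · exact hsub.antisymm h

theorem figC'_isFacet_iff (Z : Set (Fin 3)) :
    (figC' π a b c La Lb Lc).isFacet Z ↔ Z = Set.univ := by
  constructor
  · rintro ⟨-, hmax⟩
    exact hmax _ ⟨0, trivial⟩ (Set.subset_univ _)
  · rintro rfl
    exact ⟨⟨0, trivial⟩, fun Y _ h => (Set.univ_subset_iff.mp h).symm⟩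

theorem figC_exists_adjacent_edge_iff (e : A) (Q : Set (Fin 4) → Prop) :
    (∃ Y, (figC π a b c La Lb Lc).isFacet Y ∧
      e ∈ (figC π a b c La Lb Lc).χ '' ({0, 1} ∩ Y) ∧ Q Y) ↔
    ((e = a ∨ e = b) ∧ Q {0, 1}) ∨ (e = a ∧ Q {1, 2, 3}) := by
  simp only [figC_isFacet_iff, or_and_right, exists_or, exists_eq_left]
  simp [figC, Set.mem_image, Fin.exists_fin_succ, eq_comm]
  tauto

theorem figC_exists_adjacent_triangle_iff (e : A) (Q : Set (Fin 4) → Prop) :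
    (∃ Y, (figC π a b c La Lb Lc).isFacet Y ∧
      e ∈ (figC π a b c La Lb Lc).χ '' ({1, 2, 3} ∩ Y) ∧ Q Y) ↔
    (e = a ∧ Q {0, 1}) ∨ ((e = a ∨ e = b ∨ e = c) ∧ Q {1, 2, 3}) := by
  simp only [figC_isFacet_iff, or_and_right, exists_or, exists_eq_left]
  simp [figC, Set.mem_image, Fin.exists_fin_succ, eq_comm]
  tauto

theorem figC'_exists_adjacent_iff (e : A) (Q : Set (Fin 3) → Prop) :
    (∃ Y, (figC' π a b c La Lb Lc).isFacet Y ∧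
      e ∈ (figC' π a b c La Lb Lc).χ '' (Set.univ ∩ Y) ∧ Q Y) ↔
    (e = a ∨ e = b ∨ e = c) ∧ Q Set.univ := by
  simp only [figC'_isFacet_iff, exists_eq_left]
  simp [figC', Fin.exists_fin_succ, eq_comm]

/-- Whatever is defined at the edge of `𝒞` is defined at its triangle with the same truth value,
and the triangles of `𝒞` and `𝒞'` agree. -/
theorem figC_agreement (hac : a ≠ c) (hbc : b ≠ c)
    (hLa : ∀ p ∈ La, π p = a) (hLb : ∀ p ∈ Lb, π p = b) (hLc : ∀ p ∈ Lc, π p = c)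
    (φ : Form A P) (hφ : φ.NoGlobal) :
    ((figC π a b c La Lb Lc).defined {0, 1} φ →
      (figC π a b c La Lb Lc).defined {1, 2, 3} φ ∧
      ((figC π a b c La Lb Lc).sat {0, 1} φ ↔ (figC π a b c La Lb Lc).sat {1, 2, 3} φ)) ∧
    ((figC π a b c La Lb Lc).defined {1, 2, 3} φ ↔
      (figC' π a b c La Lb Lc).defined Set.univ φ) ∧
    ((figC π a b c La Lb Lc).sat {1, 2, 3} φ ↔ (figC' π a b c La Lb Lc).sat Set.univ φ) := by
  induction φ with
  | glob e => exact hφ.elim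
  | atom p =>
    have := hLc p
    refine ⟨?_, ?_, ?_⟩
    · simp [SimpModel.defined, SimpModel.sat, SimpModel.lab, figC]
      grind
    · simp [SimpModel.defined, figC, figC', Fin.exists_fin_succ]
    · simp [SimpModel.sat, SimpModel.lab, figC, figC', Fin.exists_fin_succ]
  | neg φ ih =>
    obtain ⟨hX, hd, hs⟩ := ih hφ
    exact ⟨fun h => ⟨(hX h).1, and_congr (iff_of_true h (hX h).1) (not_congr (hX h).2)⟩,
      hd, and_congr hd (not_congr hs)⟩
  | conj φ ψ ihφ ihψ =>
    obtain ⟨hφX, hφd, hφs⟩ := ihφ hφ.1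
    obtain ⟨hψX, hψd, hψs⟩ := ihψ hφ.2
    exact ⟨fun h => ⟨⟨(hφX h.1).1, (hψX h.2).1⟩, and_congr (hφX h.1).2 (hψX h.2).2⟩,
      and_congr hφd hψd, and_congr hφs hψs⟩
  | know e φ ih =>
    have h₁ := ih hφ
    have h₂ := (figC π a b c La Lb Lc).defined_of_sat
      (by intro v p; fin_cases v <;> simp [figC] <;> grind) φ {0, 1}
    simp only [SimpModel.defined, SimpModel.sat, figC_exists_adjacent_edge_iff,
      figC_exists_adjacent_triangle_iff, figC'_exists_adjacent_iff]
    obtain ⟨h₁, hd, hs⟩ := h₁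
    rw [← hd, ← hs]
    clear hd hs ih hφ hac hbc hLa hLb hLc
    generalize SimpModel.defined _ _ φ = dX at *
    generalize SimpModel.defined _ _ φ = dY at *
    generalize SimpModel.sat _ _ φ = sX at *
    generalize SimpModel.sat _ _ φ = sY at *
    by_cases e = a <;> by_cases e = b <;> by_cases e = c <;> simp_all <;> tauto

end Fig

/-- **Proposition 3.3.** The pointed simplicial models `(𝒞,Y)` and `(𝒞',Y')`
of Fig. 1 are modally equivalent in the language `L⁻` without global atoms. -/
theorem fig1_modally_equivalent_in_Lminus
    {A P : Type} [Fintype A] [Countable P] (π : P → A)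
    (a b c : A) (hab : a ≠ b) (hac : a ≠ c) (hbc : b ≠ c)
    (La Lb Lc : Set P)
    (hLa : ∀ p ∈ La, π p = a) (hLb : ∀ p ∈ Lb, π p = b) (hLc : ∀ p ∈ Lc, π p = c) :
    ModEquiv {φ : Form A P | φ.NoGlobal}
      (figC π a b c La Lb Lc) ({1, 2, 3} : Set (Fin 4))
      (figC' π a b c La Lb Lc) (Set.univ : Set (Fin 3)) := by
  intro φ hφ
  obtain ⟨-, hd, hs⟩ := figC_agreement hac hbc hLa hLb hLc φ hφ
  exact ⟨hd, hs, and_congr hd (not_congr hs)⟩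

end ISC
end

section
/- Auxiliary claim in the proof of Proposition 3.3: In the model 𝒞 of Fig. 1 described in the context, for every formula φ ∈ L⁻: if 𝒞,X ⋈ φ, then 𝒞,X ⊨ φ if and only if 𝒞,Y ⊨ φ. -/
namespace ISC

namespace SimpModel

variable {A P : Type} {π : P → A} {a b c : A} {La Lb Lc : Set P}

theorem isFacet_figC_iff {Z : Set (Fin 4)} :
    (figC π a b c La Lb Lc).isFacet Z ↔ Z = {0, 1} ∨ Z = {1, 2, 3} := by
  constructor
  · rintro ⟨⟨_, h | h⟩, hmax⟩
    · exact Or.inl (hmax _ ⟨Set.insert_nonempty _ _, Or.inl subset_rfl⟩ h)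
    · exact Or.inr (hmax _ ⟨Set.insert_nonempty _ _, Or.inr subset_rfl⟩ h)
  · rintro (rfl | rfl)
    · refine ⟨⟨Set.insert_nonempty _ _, Or.inl subset_rfl⟩, ?_⟩
      rintro W ⟨_, h | h⟩ hW
      · exact hW.antisymm h
      · have := h (hW (show (0 : Fin 4) ∈ ({0, 1} : Set (Fin 4)) by simp))
        simp at this
    · refine ⟨⟨Set.insert_nonempty _ _, Or.inr subset_rfl⟩, ?_⟩
      rintro W ⟨_, h | h⟩ hW
      · have := h (hW (show (2 : Fin 4) ∈ ({1, 2, 3} : Set (Fin 4)) by simp))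
        simp at this
      · exact hW.antisymm h

/-- The colors of each facet of `figC`, and those shared by both. -/
theorem mem_image_figC_iff (e : A) :
    (e ∈ (figC π a b c La Lb Lc).χ '' ({0, 1} : Set (Fin 4)) ↔ e = a ∨ e = b) ∧
    (e ∈ (figC π a b c La Lb Lc).χ '' ({1, 2, 3} : Set (Fin 4)) ↔ e = a ∨ e = b ∨ e = c) ∧
    (e ∈ (figC π a b c La Lb Lc).χ '' (({0, 1} : Set (Fin 4)) ∩ {1, 2, 3}) ↔ e = a) := by
  have hinter : ({0, 1} : Set (Fin 4)) ∩ {1, 2, 3} = {1} := by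
    ext v
    fin_cases v <;> simp
  rw [hinter]
  simp only [Set.image_insert_eq, Set.image_singleton, figC, Set.mem_insert_iff,
    Set.mem_singleton_iff]
  refine ⟨?_, ?_, ?_⟩ <;> simp [or_comm]

/-- Existence of an `e`-adjacent facet with property `Q` in `figC`, at the facet `{0, 1}`. -/
theorem exists_adj_figC_left (e : A) (Q : Set (Fin 4) → Prop) :
    (∃ Z, (figC π a b c La Lb Lc).isFacet Z ∧
        e ∈ (figC π a b c La Lb Lc).χ '' (({0, 1} : Set (Fin 4)) ∩ Z) ∧ Q Z) ↔
      (e = a ∧ (Q {0, 1} ∨ Q {1, 2, 3})) ∨ (e = b ∧ Q {0, 1}) := by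
  obtain ⟨h₁, -, h₃⟩ := mem_image_figC_iff (π := π) (a := a) (b := b) (c := c)
    (La := La) (Lb := Lb) (Lc := Lc) e
  simp only [isFacet_figC_iff, or_and_right, exists_or, exists_eq_left, Set.inter_self, h₁, h₃]
  tauto

/-- Existence of an `e`-adjacent facet with property `Q` in `figC`, at the facet `{1, 2, 3}`. -/
theorem exists_adj_figC_right (e : A) (Q : Set (Fin 4) → Prop) :
    (∃ Z, (figC π a b c La Lb Lc).isFacet Z ∧
        e ∈ (figC π a b c La Lb Lc).χ '' (({1, 2, 3} : Set (Fin 4)) ∩ Z) ∧ Q Z) ↔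
      (e = a ∧ (Q {0, 1} ∨ Q {1, 2, 3})) ∨ ((e = b ∨ e = c) ∧ Q {1, 2, 3}) := by
  obtain ⟨-, h₂, h₃⟩ := mem_image_figC_iff (π := π) (a := a) (b := b) (c := c)
    (La := La) (Lb := Lb) (Lc := Lc) e
  simp only [isFacet_figC_iff, or_and_right, exists_or, exists_eq_left, Set.inter_self, h₂,
    Set.inter_comm {1, 2, 3} ({0, 1} : Set (Fin 4)), h₃]
  tauto

theorem defined_figC_right_of_left {φ : Form A P}
    (h : (figC π a b c La Lb Lc).defined {0, 1} φ) :
    (figC π a b c La Lb Lc).defined {1, 2, 3} φ := by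
  induction φ with
  | glob e => trivial
  | atom p =>
    have := (mem_image_figC_iff (π p)).1.1 h
    exact (mem_image_figC_iff (π p)).2.1.2 (by tauto)
  | neg φ ih => exact ih h
  | conj φ ψ ih₁ ih₂ => exact ⟨ih₁ h.1, ih₂ h.2⟩
  | know e φ ih =>
    simp only [defined] at h ⊢
    rw [exists_adj_figC_left] at h
    rw [exists_adj_figC_right]
    tauto

end SimpModel

/-- **Auxiliary claim in the proof of Proposition 3.3.** In the model `𝒞` of
Fig. 1, for every `φ ∈ L⁻`: if `𝒞,X ⋈ φ`, then `𝒞,X ⊨ φ ↔ 𝒞,Y ⊨ φ`. -/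
theorem fig1_aux_claim
    {A P : Type} [Fintype A] [Countable P] (π : P → A)
    (a b c : A) (hab : a ≠ b) (hac : a ≠ c) (hbc : b ≠ c)
    (La Lb Lc : Set P)
    (hLa : ∀ p ∈ La, π p = a) (hLb : ∀ p ∈ Lb, π p = b) (hLc : ∀ p ∈ Lc, π p = c) :
    ∀ φ : Form A P, φ.NoGlobal →
      (figC π a b c La Lb Lc).defined ({0, 1} : Set (Fin 4)) φ →
      ((figC π a b c La Lb Lc).sat ({0, 1} : Set (Fin 4)) φ ↔
        (figC π a b c La Lb Lc).sat ({1, 2, 3} : Set (Fin 4)) φ) := by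
  intro φ hφ hX
  induction φ with
  | glob e => exact hφ.elim
  | atom p =>
    have hp : π p = a ∨ π p = b := (SimpModel.mem_image_figC_iff (π p)).1.1 hX
    have hpc : p ∉ Lc := fun h => by
      have := hLc p h
      rcases hp with hp | hp
      · exact hac (hp.symm.trans this)
      · exact hbc (hp.symm.trans this)
    simp [SimpModel.sat, SimpModel.lab, figC, hpc, or_comm]
  | neg φ ih =>
    have hY := SimpModel.defined_figC_right_of_left hX
    exact and_congr (iff_of_true hX hY) (not_congr (ih hφ hX))
  | conj φ ψ ih₁ ih₂ => exact and_congr (ih₁ hφ.1 hX.1) (ih₂ hφ.2 hX.2)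
  | know e φ ih =>
    simp only [SimpModel.defined, SimpModel.sat] at hX ⊢
    rw [SimpModel.exists_adj_figC_left] at hX
    rw [SimpModel.exists_adj_figC_left, SimpModel.exists_adj_figC_right]
    rcases hX with ⟨rfl, -⟩ | ⟨rfl, hX⟩
    · simp [hab, hac]
    · simp [hab.symm, hbc, ih hφ hX]

end ISC
end

section
/- Theorem 4.2 (Bisimilarity implies modal equivalence): For arbitrary pointed simplicial models (𝒞,X) and (𝒞',X'), if (𝒞,X) ⇄ (𝒞',X') (they are bisimilar), then (𝒞,X) ≡_{L⁺} (𝒞',X'). -/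
namespace ISC

namespace IsBisim

variable {A P V V' : Type} {π : P → A} {M : SimpModel A P π V} {M' : SimpModel A P π V'}
  {B : Set V → Set V' → Prop}

/-- Definability is invariant under bisimulation. -/
theorem defined_iff (hB : IsBisim M M' B) (φ : Form A P) {X : Set V} {X' : Set V'}
    (h : B X X') : M.defined X φ ↔ M'.defined X' φ := by
  induction φ generalizing X X' with
  | glob a => exact Iff.rfl
  | atom p => simp only [SimpModel.defined, (hB.2.2 X X' h).1.1]
  | neg φ ih => exact ih h
  | conj φ ψ ihφ ihψ => exact and_congr (ihφ h) (ihψ h)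
  | know a φ ih =>
    obtain ⟨-, forth, back⟩ := hB.2.2 X X' h
    constructor
    · rintro ⟨Y, hY, ha, hφ⟩
      obtain ⟨Y', hY', ha', hYY'⟩ := forth a Y hY ha
      exact ⟨Y', hY', ha', (ih hYY').1 hφ⟩
    · rintro ⟨Y', hY', ha', hφ⟩
      obtain ⟨Y, hY, ha, hYY'⟩ := back a Y' hY' ha'
      exact ⟨Y, hY, ha, (ih hYY').2 hφ⟩

/-- Satisfaction is invariant under bisimulation. -/
theorem sat_iff (hB : IsBisim M M' B) (φ : Form A P) {X : Set V} {X' : Set V'}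
    (h : B X X') : M.sat X φ ↔ M'.sat X' φ := by
  induction φ generalizing X X' with
  | glob a => simp only [SimpModel.sat, (hB.2.2 X X' h).1.1]
  | atom p => simp only [SimpModel.sat, (hB.2.2 X X' h).1.2]
  | neg φ ih => exact and_congr (hB.defined_iff φ h) (not_congr (ih h))
  | conj φ ψ ihφ ihψ => exact and_congr (ihφ h) (ihψ h)
  | know a φ ih =>
    obtain ⟨-, forth, back⟩ := hB.2.2 X X' h
    constructor
    · rintro ⟨Y, hY, ha, hφ⟩
      obtain ⟨Y', hY', ha', hYY'⟩ := forth a Y hY ha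
      exact ⟨Y', hY', ha', (ih hYY').1 hφ⟩
    · rintro ⟨Y', hY', ha', hφ⟩
      obtain ⟨Y, hY, ha, hYY'⟩ := back a Y' hY' ha'
      exact ⟨Y, hY, ha, (ih hYY').2 hφ⟩

end IsBisim

/-- **Theorem 4.2 (Bisimilarity implies modal equivalence).** For arbitrary
pointed simplicial models, `(𝒞,X) ⇄ (𝒞',X')` implies `(𝒞,X) ≡_{L⁺} (𝒞',X')`. -/
theorem bisimilarity_implies_modal_equivalence
    {A P V V' : Type} [Fintype A] [Countable P] {π : P → A}
    (M : SimpModel A P π V) (M' : SimpModel A P π V')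
    (hM : M.IsWellFormed) (hM' : M'.IsWellFormed)
    (X : Set V) (X' : Set V') (hX : M.isFacet X) (hX' : M'.isFacet X')
    (h : Bisimilar M X M' X') :
    ModEquiv Set.univ M X M' X' := by
  obtain ⟨B, hB, hXX'⟩ := h
  exact fun φ _ => ⟨hB.defined_iff φ hXX', hB.sat_iff φ hXX', hB.sat_iff φ.neg hXX'⟩

end ISC
end

section
/- Proposition 4.3: Let a, b, c ∈ A be pairwise distinct agents, p_a ∈ P_a, p_c ∈ P_c, and let φ = p_a ∧ K_b p_c, where K_b ψ abbreviates ¬K̂_b ¬ψ. Then there is no formula φ* ∈ L⁺ such that for all pointed simplicial models (𝒞,X): 𝒞,X ⋈̸ φ if and only if 𝒞,X ⊨ φ*. -/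
namespace ISC

/-- Boolean combinations of global atoms. -/
def Form.PureGlobal {A P : Type} : Form A P → Prop
  | .glob _ => True
  | .atom _ => False
  | .neg φ => φ.PureGlobal
  | .conj φ ψ => φ.PureGlobal ∧ ψ.PureGlobal
  | .know _ _ => False

namespace SimpModel

variable {A P : Type} {π : P → A} {V V' : Type}

theorem defined_of_sat_s4 {M : SimpModel A P π V} (hM : M.IsWellFormed)
    (φ : Form A P) (X : Set V) (h : M.sat X φ) : M.defined X φ := by
  induction φ generalizing X with
  | glob a => exact trivial
  | atom p =>
    obtain ⟨v, hv, hp⟩ := Set.mem_iUnion₂.mp h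
    exact ⟨v, hv, (hM.2.2.2.2.2 v p hp).symm⟩
  | neg φ _ => exact h.1
  | conj φ ψ ihφ ihψ => exact ⟨ihφ X h.1, ihψ X h.2⟩
  | know a φ ih =>
    obtain ⟨Y, hY, ha, hs⟩ := h
    exact ⟨Y, hY, ha, ih Y hs⟩

theorem defined_of_pureGlobal (M : SimpModel A P π V) (X : Set V) {φ : Form A P}
    (hφ : φ.PureGlobal) : M.defined X φ := by
  induction φ with
  | glob a => exact trivial
  | atom p => exact hφ.elim
  | neg φ ih => exact ih hφ
  | conj φ ψ ihφ ihψ => exact ⟨ihφ hφ.1, ihψ hφ.2⟩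
  | know a φ _ => exact hφ.elim

/-- The truth value of a Boolean combination of global atoms depends only on the
colors of the facet. -/
theorem sat_congr_of_pureGlobal {M : SimpModel A P π V} {M' : SimpModel A P π V'}
    {X : Set V} {X' : Set V'} (hX : M.χ '' X = M'.χ '' X') {φ : Form A P}
    (hφ : φ.PureGlobal) : M.sat X φ ↔ M'.sat X' φ := by
  induction φ with
  | glob a => simp only [sat, hX]
  | atom p => exact hφ.elim
  | neg φ ih =>
    exact and_congr (iff_of_true (M.defined_of_pureGlobal X hφ) (M'.defined_of_pureGlobal X' hφ))
      (not_congr (ih hφ))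
  | conj φ ψ ihφ ihψ => exact and_congr (ihφ hφ.1) (ihψ hφ.2)
  | know a φ _ => exact hφ.elim

/-- A formula defined at two facets without common color is a Boolean combination of
global atoms. -/
theorem pureGlobal_of_defined_of_disjoint {M : SimpModel A P π V} {M' : SimpModel A P π V'}
    {X : Set V} {X' : Set V'} (hd : Disjoint (M.χ '' X) (M'.χ '' X')) {φ : Form A P}
    (h : M.defined X φ) (h' : M'.defined X' φ) : φ.PureGlobal := by
  induction φ with
  | glob a => exact trivial
  | atom p => exact Set.disjoint_left.mp hd h h'
  | neg φ ih => exact ih h h'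
  | conj φ ψ ihφ ihψ => exact ⟨ihφ h.1 h'.1, ihψ h.2 h'.2⟩
  | know a φ _ =>
    obtain ⟨Y, _, ha, _⟩ := h
    obtain ⟨Y', _, ha', _⟩ := h'
    exact Set.disjoint_left.mp hd (Set.image_mono Set.inter_subset_left ha)
      (Set.image_mono Set.inter_subset_left ha')

/-- The model with one vertex per agent and no true local atoms, whose simplexes are the
singletons and the nonempty subsets of members of `S`. -/
def ofSets (π : P → A) (S : Set (Set A)) : SimpModel A P π A where
  C := {X | X.Nonempty ∧ (X.Subsingleton ∨ ∃ F ∈ S, X ⊆ F)}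
  χ := id
  ℓ := fun _ => ∅

theorem ofSets_isWellFormed [Finite A] [Nonempty A] (S : Set (Set A)) :
    (ofSets π S).IsWellFormed := by
  have hsing (v : A) : {v} ∈ (ofSets π S).C :=
    ⟨Set.singleton_nonempty v, .inl Set.subsingleton_singleton⟩
  refine ⟨⟨_, hsing (Classical.arbitrary A)⟩, fun X hX => ⟨X.toFinite, hX.1⟩, ?_, hsing,
    fun X _ u _ w _ huw => huw, fun v p hp => hp.elim⟩
  rintro X ⟨_, hX⟩ Y hY hYX
  exact ⟨hY, hX.imp (fun h => h.anti hYX) fun ⟨F, hF, hXF⟩ => ⟨F, hF, hYX.trans hXF⟩⟩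

theorem ofSets_empty_isFacet (x : A) : (ofSets π ∅).isFacet {x} := by
  refine ⟨⟨Set.singleton_nonempty x, .inl Set.subsingleton_singleton⟩, ?_⟩
  rintro Y ⟨_, hY | ⟨F, hF, _⟩⟩ hxY
  · exact hxY.antisymm fun y hy => hY hy (hxY rfl)
  · exact hF.elim

theorem ofSets_isFacet {S : Set (Set A)} {F : Set A} (hF : F ∈ S) (hnt : F.Nontrivial)
    (hmax : ∀ G ∈ S, F ⊆ G → G ⊆ F) : (ofSets π S).isFacet F := by
  refine ⟨⟨hnt.nonempty, .inr ⟨F, hF, subset_rfl⟩⟩, ?_⟩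
  rintro Y ⟨_, hY | ⟨G, hG, hYG⟩⟩ hFY
  · exact (hnt.not_subsingleton (hY.anti hFY)).elim
  · exact hFY.antisymm (hYG.trans (hmax G hG (hFY.trans hYG)))

end SimpModel

/-- **Proposition 4.3.** For `φ = p_a ∧ K_b p_c` (where `K_b ψ := ¬K̂_b ¬ψ`),
there is no formula `φ* ∈ L⁺` such that for all pointed simplicial models
`(𝒞,X)`: `𝒞,X ⋈̸ φ` iff `𝒞,X ⊨ φ*`. -/
theorem no_uniform_undefinedness_formula
    {A P : Type} [Fintype A] [Countable P] (π : P → A)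
    (a b c : A) (hab : a ≠ b) (hac : a ≠ c) (hbc : b ≠ c)
    (pa pc : P) (hpa : π pa = a) (hpc : π pc = c) :
    ¬ ∃ φstar : Form A P,
        ∀ (V : Type) (M : SimpModel A P π V) (X : Set V),
          M.IsWellFormed → M.isFacet X →
          (¬ M.defined X
              (Form.conj (Form.atom pa)
                (Form.neg (Form.know b (Form.neg (Form.atom pc))))) ↔
            M.sat X φstar) := by
  rintro ⟨φ, h⟩
  have : Nonempty A := ⟨a⟩
  have wf (S : Set (Set A)) : (SimpModel.ofSets π S).IsWellFormed :=
    SimpModel.ofSets_isWellFormed S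
  have defA : (SimpModel.ofSets π ∅).defined {a} φ := by
    refine SimpModel.defined_of_sat_s4 (wf _) _ _
      ((h _ _ _ (wf _) (SimpModel.ofSets_empty_isFacet a)).mp ?_)
    rintro ⟨_, Y, _, ⟨v, hv, hvb⟩, _⟩
    exact hab (hv.1.symm.trans hvb)
  have defB : (SimpModel.ofSets π ∅).defined {b} φ := by
    refine SimpModel.defined_of_sat_s4 (wf _) _ _
      ((h _ _ _ (wf _) (SimpModel.ofSets_empty_isFacet b)).mp ?_)
    rintro ⟨⟨v, hv, hva⟩, _⟩
    exact hab ((hva.trans hpa).symm.trans hv)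
  have hφ : φ.PureGlobal := by
    refine SimpModel.pureGlobal_of_defined_of_disjoint ?_ defA defB
    simpa [SimpModel.ofSets] using hab
  have satAB : (SimpModel.ofSets π {{a, b}}).sat {a, b} φ := by
    refine (h _ _ _ (wf _)
      (SimpModel.ofSets_isFacet (Set.mem_singleton _) (Set.nontrivial_pair hab) (by simp))).mp ?_
    rintro ⟨_, Y, ⟨⟨_, hY⟩, _⟩, ⟨v, hv, hvb⟩, ⟨w, hw, hwc⟩⟩
    obtain rfl : v = b := hvb
    obtain rfl : w = c := hwc.trans hpc
    rcases hY with hY | ⟨F, rfl, hY⟩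
    · exact hbc (hY hv.2 hw)
    · rcases hY hw with rfl | rfl
      · exact hac rfl
      · exact hbc rfl
  have facetAB : (SimpModel.ofSets π {{a, b}, {b, c}}).isFacet {a, b} := by
    refine SimpModel.ofSets_isFacet (by simp) (Set.nontrivial_pair hab) ?_
    rintro G (rfl | rfl) hG
    · exact subset_rfl
    · rcases hG (Set.mem_insert a {b}) with h | h
      · exact (hab h).elim
      · exact (hac h).elim
  have facetBC : (SimpModel.ofSets π {{a, b}, {b, c}}).isFacet {b, c} := by
    refine SimpModel.ofSets_isFacet (by simp) (Set.nontrivial_pair hbc) ?_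
    rintro G (rfl | rfl) hG
    · rcases hG (Set.mem_insert_of_mem b rfl : c ∈ ({b, c} : Set A)) with h | h
      · exact (hac h.symm).elim
      · exact (hbc h.symm).elim
    · exact subset_rfl
  have satABC : (SimpModel.ofSets π {{a, b}, {b, c}}).sat {a, b} φ :=
    (SimpModel.sat_congr_of_pureGlobal (by rfl) hφ).mp satAB
  refine (h _ _ _ (wf _) facetAB).mpr satABC ?_
  exact ⟨⟨a, by simp, hpa.symm⟩, {b, c}, facetBC, ⟨b, by simp, rfl⟩, ⟨c, by simp, hpc.symm⟩⟩

end ISC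
end

section
/- Lemma 4.9 (Equivalence of embeddability and definability): For any formula φ ∈ L⁺ and any pointed simplicial model (𝒞,X): 𝒞,X ⋈ φ if and only if 𝒞,X ⋈ ℒ⟨φ⟩ (i.e., iff there exists an embedding of the life tree ℒ⟨φ⟩ into (𝒞,X)). -/
namespace ISC

namespace SimpModel

variable {A P : Type} {π : P → A} {V : Type}

theorem embeds_iff (M : SimpModel A P π V) (X : Set V) (T : LTree A) :
    M.Embeds X T ↔ T.label ⊆ M.χ '' X ∧
      ∀ p ∈ T.children, ∃ Y : Set V,
        M.isFacet Y ∧ p.1 ∈ M.χ '' (X ∩ Y) ∧ M.Embeds Y p.2 := by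
  cases T with
  | node s cs => rw [Embeds]; rfl

theorem embeds_graft_iff (M : SimpModel A P π V) (X : Set V) (a : A) (T : LTree A) :
    M.Embeds X (T.graft a) ↔ a ∈ M.χ '' X ∧ M.Embeds X T := by
  cases T with
  | node s cs =>
    rw [LTree.graft, embeds_iff, embeds_iff]
    simp only [LTree.label, LTree.children, Set.insert_subset_iff, and_assoc]

theorem embeds_merge_iff (M : SimpModel A P π V) (X : Set V) (S T : LTree A) :
    M.Embeds X (.node (S.label ∪ T.label) (S.children ++ T.children)) ↔
      M.Embeds X S ∧ M.Embeds X T := by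
  rw [embeds_iff, embeds_iff M X S, embeds_iff M X T]
  simp only [LTree.label, LTree.children, Set.union_subset_iff, List.forall_mem_append]
  tauto

theorem embeds_single_child_iff (M : SimpModel A P π V) (X : Set V) (a : A) (T : LTree A) :
    M.Embeds X (.node {a} [(a, T.graft a)]) ↔
      ∃ Y : Set V, M.isFacet Y ∧ a ∈ M.χ '' (X ∩ Y) ∧ M.Embeds Y T := by
  rw [embeds_iff]
  simp only [LTree.label, LTree.children, Set.singleton_subset_iff, List.forall_mem_singleton,
    embeds_graft_iff]
  constructor
  · rintro ⟨-, Y, hY, ha, -, hT⟩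
    exact ⟨Y, hY, ha, hT⟩
  · rintro ⟨Y, hY, ha, hT⟩
    exact ⟨Set.image_mono Set.inter_subset_left ha, Y, hY, ha,
      Set.image_mono Set.inter_subset_right ha, hT⟩

theorem defined_iff_embeds_lifeTree (M : SimpModel A P π V) (X : Set V) (φ : Form A P) :
    M.defined X φ ↔ M.Embeds X (φ.lifeTree π) := by
  induction φ generalizing X with
  | glob a => simp [defined, Form.lifeTree, Embeds]
  | atom p => simp [defined, Form.lifeTree, Embeds]
  | neg φ ih => exact ih X
  | conj φ ψ ihφ ihψ => rw [defined, Form.lifeTree, embeds_merge_iff, ihφ, ihψ]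
  | know a φ ih => simp only [defined, Form.lifeTree, embeds_single_child_iff, ih]

end SimpModel

/-- **Lemma 4.9 (Equivalence of embeddability and definability).** For any
`φ ∈ L⁺` and pointed simplicial model `(𝒞,X)`: `𝒞,X ⋈ φ` iff there exists an
embedding of the life tree `ℒ⟨φ⟩` into `(𝒞,X)`. -/
theorem embeddability_iff_definability
    {A P V : Type} [Fintype A] [Countable P] {π : P → A}
    (M : SimpModel A P π V) (hM : M.IsWellFormed)
    (X : Set V) (hX : M.isFacet X) (φ : Form A P) :
    M.defined X φ ↔ M.Embeds X (φ.lifeTree π) :=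
  M.defined_iff_embeds_lifeTree X φ

end ISC
end

section
/- Lemma 4.10 (Criterion of non-embeddability): Let (𝒞,X) be a pointed simplicial model with 𝒞 = (C,χ,ℓ) and let ℒ⟨φ⟩ = ((V,E),L) with root ρ be the life tree of a formula φ ∈ L⁺. Then 𝒞,X ⋈̸ ℒ⟨φ⟩ if and only if at least one of the following holds: (1) L(ρ) ⊄ χ(X); or (2) there exist a subformula ψ of φ, an agent a ∈ A, and an a-labeled edge (ρ, ρ_ψ) ∈ E from the root to the root ρ_ψ of a subtree of ℒ⟨φ⟩ equal to the a-grafting ℒ⟨ψ⟩^a, such that 𝒞,Y ⋈̸ ℒ⟨ψ⟩ for every facet Y ∈ ℱ(C) with a ∈ χ(X ∩ Y). -/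
namespace ISC

/-- Embeddability of a tree in terms of its root label and its children. -/
theorem SimpModel.embeds_iff_s7 {A P : Type} {π : P → A} {V : Type}
    (M : SimpModel A P π V) (X : Set V) (T : LTree A) :
    M.Embeds X T ↔ T.label ⊆ M.χ '' X ∧
      ∀ p ∈ T.children, ∃ Y : Set V, M.isFacet Y ∧ p.1 ∈ M.χ '' (X ∩ Y) ∧ M.Embeds Y p.2 := by
  obtain ⟨s, cs⟩ := T
  rw [SimpModel.Embeds]
  rfl

/-- Grafting an agent alive in a simplex does not affect embeddability. -/
theorem SimpModel.embeds_graft_iff_s7 {A P : Type} {π : P → A} {V : Type}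
    (M : SimpModel A P π V) {a : A} {Y : Set V} (ha : a ∈ M.χ '' Y) (T : LTree A) :
    M.Embeds Y (LTree.graft a T) ↔ M.Embeds Y T := by
  obtain ⟨s, cs⟩ := T
  rw [LTree.graft, SimpModel.Embeds, SimpModel.Embeds, Set.insert_subset_iff]
  simp only [ha, true_and]

/-- Every child of the root of a life tree is the grafting of the life tree of a subformula. -/
theorem Form.exists_subformula_of_mem_children {A P : Type} (π : P → A) (φ : Form A P)
    {p : A × LTree A} (hp : p ∈ (φ.lifeTree π).children) :
    ∃ ψ : Form A P, ψ.Subformula φ ∧ p.2 = LTree.graft p.1 (ψ.lifeTree π) := by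
  induction φ with
  | glob a => simp [Form.lifeTree, LTree.children] at hp
  | atom q => simp [Form.lifeTree, LTree.children] at hp
  | neg φ ih =>
    obtain ⟨ψ, hψ, h⟩ := ih hp
    exact ⟨ψ, .neg hψ, h⟩
  | conj φ χ ihφ ihχ =>
    rcases List.mem_append.mp hp with hp | hp
    · obtain ⟨ψ, hψ, h⟩ := ihφ hp
      exact ⟨ψ, .conj_left hψ, h⟩
    · obtain ⟨ψ, hψ, h⟩ := ihχ hp
      exact ⟨ψ, .conj_right hψ, h⟩
  | know a φ =>
    obtain rfl := List.mem_singleton.mp hp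
    exact ⟨φ, .know (.refl φ), rfl⟩

/-- **Lemma 4.10 (Criterion of non-embeddability).** `𝒞,X ⋈̸ ℒ⟨φ⟩` iff either
(1) the root label of `ℒ⟨φ⟩` is not included in `χ(X)`, or (2) there are a
subformula `ψ` of `φ` and an `a`-labeled edge from the root of `ℒ⟨φ⟩` to the
root of a subtree equal to the `a`-grafting `ℒ⟨ψ⟩^a` such that `𝒞,Y ⋈̸ ℒ⟨ψ⟩`
for every facet `Y` that is `a`-adjacent to `X`. -/
theorem non_embeddability_criterion
    {A P V : Type} [Fintype A] [Countable P] {π : P → A}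
    (M : SimpModel A P π V) (hM : M.IsWellFormed)
    (X : Set V) (hX : M.isFacet X) (φ : Form A P) :
    ¬ M.Embeds X (φ.lifeTree π) ↔
      (¬ (φ.lifeTree π).label ⊆ M.χ '' X ∨
       ∃ (ψ : Form A P) (a : A), ψ.Subformula φ ∧
         (a, LTree.graft a (ψ.lifeTree π)) ∈ (φ.lifeTree π).children ∧
         ∀ Y : Set V, M.isFacet Y → a ∈ M.χ '' (X ∩ Y) →
           ¬ M.Embeds Y (ψ.lifeTree π)) := by
  have graft_iff {a : A} {Y : Set V} (ha : a ∈ M.χ '' (X ∩ Y)) (T : LTree A) :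
      M.Embeds Y (LTree.graft a T) ↔ M.Embeds Y T :=
    M.embeds_graft_iff_s7 (Set.image_mono Set.inter_subset_right ha) T
  rw [M.embeds_iff_s7, not_and_or]
  refine or_congr_right ⟨fun h => ?_, ?_⟩
  · push Not at h
    obtain ⟨⟨a, T⟩, hp, h⟩ := h
    obtain ⟨ψ, hψ, hT⟩ := φ.exists_subformula_of_mem_children π hp
    obtain rfl : T = LTree.graft a (ψ.lifeTree π) := hT
    exact ⟨ψ, a, hψ, hp, fun Y hY ha hE => h Y hY ha ((graft_iff ha _).mpr hE)⟩
  · rintro ⟨ψ, a, -, hp, h⟩ hall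
    obtain ⟨Y, hY, ha, hE⟩ := hall _ hp
    exact h Y hY ha ((graft_iff ha _).mp hE)

end ISC
end
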